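/- arXiv:1306.2515 — 3 statements merged into one kernel-verified Lean document; each statement's English description precedes it below -/
import Mathlib

section
/- (Descartes–Soddy–Gossett theorem, packing case.) Let d ≥ 2 and let c_1, …, c_{d+2} ∈ ℝ^d and r_1, …, r_{d+2} > 0 satisfy ‖c_i − c_j‖ = r_i + r_j for all i ≠ j (i.e., the d+2 closed balls B(c_i, r_i) are pairwise externally tangent, forming a Descartes configuration). Then the curvatures κ_i = 1/r_i satisfy Σ_{i=1}^{d+2} κ_i² = (1/d)·(Σ_{i=1}^{d+2} κ_i)². -/
/-- The inverse of the matrix with entries `2 - 4 δᵢⱼ` of size `d + 2`. -/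
theorem two_sub_four_delta_mul_inverse (d : ℕ) (hd : (d : ℝ) ≠ 0) :
    (Matrix.of fun i j : Fin (d + 2) => (2 - if i = j then 4 else 0 : ℝ)) *
      (Matrix.of fun i j : Fin (d + 2) => (1 / (4 * d) - if i = j then 1 / 4 else 0 : ℝ)) = 1 := by
  ext i j
  simp only [Matrix.mul_apply, Matrix.of_apply, sub_mul, mul_sub, Finset.sum_sub_distrib,
    ite_mul, mul_ite, zero_mul, mul_zero, Finset.sum_ite_eq, Finset.sum_ite_eq',
    Finset.mem_univ, if_true, Finset.sum_const, Finset.card_univ, Fintype.card_fin,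
    Matrix.one_apply, nsmul_eq_mul]
  push_cast
  split_ifs <;> field_simp <;> ring

/-- Curvature-center coordinates of pairwise tangent balls have Gram matrix `2 - 4 δᵢⱼ` for the
Lorentzian form. -/
theorem lorentz_form_of_tangent {ι E : Type*} [DecidableEq ι] [NormedAddCommGroup E]
    [InnerProductSpace ℝ E] (c : ι → E) (r : ι → ℝ) (hr : ∀ i, 0 < r i)
    (htangent : ∀ i j, i ≠ j → dist (c i) (c j) = r i + r j) (i j : ι) :
    (r i)⁻¹ * ((r j)⁻¹ * (‖c j‖ ^ 2 - r j ^ 2)) + (r i)⁻¹ * (‖c i‖ ^ 2 - r i ^ 2) * (r j)⁻¹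
      - 2 * ((r i)⁻¹ * (r j)⁻¹ * inner ℝ (c i) (c j)) = 2 - if i = j then 4 else 0 := by
  have hi := (hr i).ne'
  have hj := (hr j).ne'
  split_ifs with h
  · subst h
    rw [real_inner_self_eq_norm_sq]
    field_simp
    ring
  · have h1 := htangent i j h
    have h2 := norm_sub_sq_real (c i) (c j)
    rw [← dist_eq_norm, h1] at h2
    field_simp
    linarith


/-- Descartes–Soddy–Gossett theorem, packing case.
If `d ≥ 2` and the `d+2` closed balls `B(c i, r i)` in `ℝ^d` are pairwise
externally tangent (`dist (c i) (c j) = r i + r j` for `i ≠ j`), forming a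
Descartes configuration, then the curvatures `κ i = 1 / r i` satisfy
`∑ κ i ^ 2 = (1/d) * (∑ κ i) ^ 2`. -/
theorem descartes_soddy_gossett (d : ℕ) (hd : 2 ≤ d)
    (c : Fin (d + 2) → EuclideanSpace ℝ (Fin d)) (r : Fin (d + 2) → ℝ)
    (hr : ∀ i, 0 < r i)
    (htangent : ∀ i j, i ≠ j → dist (c i) (c j) = r i + r j) :
    ∑ i, (1 / r i) ^ 2 = (1 / (d : ℝ)) * (∑ i, 1 / r i) ^ 2 := by
  have hd0 : (d : ℝ) ≠ 0 := by positivity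
  let V : Matrix (Fin (d + 2)) (Fin (d + 2)) ℝ := fun i =>
    Fin.cons (r i)⁻¹ (Fin.cons ((r i)⁻¹ * (‖c i‖ ^ 2 - r i ^ 2)) fun k => (r i)⁻¹ * c i k)
  let U : Matrix (Fin (d + 2)) (Fin (d + 2)) ℝ := fun k i =>
    (Fin.cons ((r i)⁻¹ * (‖c i‖ ^ 2 - r i ^ 2))
      (Fin.cons (r i)⁻¹ fun k => -2 * ((r i)⁻¹ * c i k)) : Fin (d + 2) → ℝ) k
  have hVU : V * U = Matrix.of fun i j => (2 - if i = j then 4 else 0 : ℝ) := by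
    ext i j
    rw [Matrix.of_apply, ← lorentz_form_of_tangent c r hr htangent i j, Matrix.mul_apply,
      Fin.sum_univ_succ, Fin.sum_univ_succ]
    simp only [V, U, Fin.cons_zero, Fin.cons_succ, PiLp.inner_apply, RCLike.inner_apply,
      conj_trivial, Finset.mul_sum]
    rw [← add_assoc, sub_eq_add_neg _ (Finset.sum _ _), ← Finset.sum_neg_distrib]
    congr 1
    exact Finset.sum_congr rfl fun k _ => by ring
  have hinv := two_sub_four_delta_mul_inverse d hd0
  rw [← hVU, Matrix.mul_assoc, mul_eq_one_comm] at hinv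
  have h := congrFun (congrFun hinv 1) 0
  have hU : ∀ i, U 1 i = (r i)⁻¹ := fun i => rfl
  have hV : ∀ i, V i 0 = (r i)⁻¹ := fun i => rfl
  simp only [Matrix.mul_apply, hU, hV, Matrix.of_apply, mul_sub, Finset.sum_sub_distrib,
    mul_ite, mul_zero, Finset.sum_ite_eq', Finset.mem_univ, if_true, sub_mul,
    ← Finset.sum_mul, ← Finset.mul_sum] at h
  rw [Matrix.one_apply_ne (by simp)] at h
  have hsq : ∑ i, (r i)⁻¹ * (1 / 4) * (r i)⁻¹ = 1 / 4 * ∑ i, (r i)⁻¹ ^ 2 := by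
    rw [Finset.mul_sum]
    exact Finset.sum_congr rfl fun i _ => by ring
  rw [hsq] at h
  simp only [one_div] at h ⊢
  field_simp at h ⊢
  linarith
end

section
/- Let w ∈ ℚ^5 be a weight vector such that Σ^w(R_i) ≥ Σ^w(I) for every 1 ≤ i ≤ 5, where Σ^w(U) = eᵀUw. Then for every reduced word U = U_1U_2⋯U_n over {R_1,…,R_5} with n ≥ 1, writing U_1 = R_i and U' = U_2⋯U_n (so U = R_iU' as a matrix product, with U' = I when n = 1), one has Σ^w(U) ≥ Σ^w(U'). -/
/-! ## The Apollonian group and its generators -/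

/-- The generator `R_i = I + (2/(d−1)) eᵢ eᵀ − (2d/(d−1)) eᵢ eᵢᵀ` of the
`d`-dimensional Apollonian group, as a `(d+2) × (d+2)` rational matrix:
it agrees with the identity matrix on every row except the `i`-th row, whose
diagonal entry is `−1` and whose off-diagonal entries are `2/(d−1)`. -/
def apollonianGen (d : ℕ) (i : Fin (d + 2)) :
    Matrix (Fin (d + 2)) (Fin (d + 2)) ℚ := fun j k =>
  if j = i then (if k = i then -1 else 2 / ((d : ℚ) - 1))
  else (if j = k then 1 else 0)

/-- The weighted row sum `σ_i^w(U) = eᵢᵀ U w`. -/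
def weightedRowSum {n : ℕ} (w : Fin n → ℚ) (U : Matrix (Fin n) (Fin n) ℚ)
    (i : Fin n) : ℚ :=
  U.mulVec w i

/-- The weighted mass `Σ^w(U) = eᵀ U w`. -/
def weightedMass {n : ℕ} (w : Fin n → ℚ) (U : Matrix (Fin n) (Fin n) ℚ) : ℚ :=
  ∑ i, U.mulVec w i

/-! ## Reduced words over the generators of the 3-dimensional Apollonian group -/

/-- A forbidden contiguous pattern: either `R_i R_i`, or a word
`V_1 V_2 ⋯ V_{2m}` with `m ≥ 2` such that `V_1 = V_3`, `V_{2m−2} = V_{2m}` and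
`V_{2j} = V_{2j+3}` for all `1 ≤ j ≤ m − 2`.  (Letters are recorded by their
indices; `f t` is the `(t+1)`-st letter `V_{t+1}`.) -/
def IsBadPattern (B : List (Fin 5)) : Prop :=
  (∃ i : Fin 5, B = [i, i]) ∨
  (∃ (m : ℕ) (f : ℕ → Fin 5), 2 ≤ m ∧ B = (List.range (2 * m)).map f ∧
    f 0 = f 2 ∧ f (2 * m - 3) = f (2 * m - 1) ∧
    ∀ j : ℕ, 1 ≤ j → j ≤ m - 2 → f (2 * j - 1) = f (2 * j + 2))

/-- A word over `{R_1, …, R_5}` (recorded as a list of indices, first letter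
first) is reduced if it contains no contiguous forbidden pattern. -/
def IsReducedWord (L : List (Fin 5)) : Prop :=
  ¬ ∃ A B C : List (Fin 5), L = A ++ B ++ C ∧ IsBadPattern B

/-- The mass gained when the generator `R_i` acts on `v`, i.e. the coordinates of `v` in the
geometric representation of the Coxeter group with all `m_{ij} = 3`. -/
def massGain (v : Fin 5 → ℚ) (i : Fin 5) : ℚ := ∑ k, v k - 3 * v i

theorem apollonianGen_mulVec (i : Fin 5) (v : Fin 5 → ℚ) (j : Fin 5) :
    (apollonianGen 3 i).mulVec v j = v j + if j = i then massGain v i else 0 := by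
  fin_cases i <;> fin_cases j <;>
    simp [Matrix.mulVec, dotProduct, Fin.sum_univ_five, apollonianGen, massGain] <;> ring

theorem sum_apollonianGen_mulVec (i : Fin 5) (v : Fin 5 → ℚ) :
    ∑ j, (apollonianGen 3 i).mulVec v j = ∑ j, v j + massGain v i := by
  simp [apollonianGen_mulVec, Finset.sum_add_distrib]

theorem massGain_apollonianGen_mulVec_self (i : Fin 5) (v : Fin 5 → ℚ) :
    massGain ((apollonianGen 3 i).mulVec v) i = -massGain v i := by
  rw [massGain, sum_apollonianGen_mulVec, apollonianGen_mulVec, if_pos rfl, massGain]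
  ring

theorem massGain_apollonianGen_mulVec_of_ne {i j : Fin 5} (h : j ≠ i) (v : Fin 5 → ℚ) :
    massGain ((apollonianGen 3 i).mulVec v) j = massGain v j + massGain v i := by
  rw [massGain, sum_apollonianGen_mulVec, apollonianGen_mulVec, if_neg h, massGain, massGain]
  ring

theorem weightedMass_apollonianGen_mul (w : Fin 5 → ℚ) (i : Fin 5)
    (M : Matrix (Fin 5) (Fin 5) ℚ) :
    weightedMass w (apollonianGen 3 i * M) = weightedMass w M + massGain (M.mulVec w) i := by
  rw [weightedMass, weightedMass, ← Matrix.mulVec_mulVec, sum_apollonianGen_mulVec]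

/-- The vector obtained from `w` by applying the letters of a word, last letter first. -/
def wordAction (w : Fin 5 → ℚ) (L : List (Fin 5)) : Fin 5 → ℚ :=
  (L.map (apollonianGen 3)).prod.mulVec w

theorem wordAction_cons (w : Fin 5 → ℚ) (i : Fin 5) (L : List (Fin 5)) :
    wordAction w (i :: L) = (apollonianGen 3 i).mulVec (wordAction w L) := by
  simp [wordAction]

/-- `LeftDescent j L` says that prepending `j` to the word `L` creates a forbidden initial segment:
either `L` starts with `j`, or it starts with `a j` and `a` is a left descent of the rest. -/
def LeftDescent : Fin 5 → List (Fin 5) → Prop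
  | _, [] => False
  | j, [a] => j = a
  | j, a :: b :: L => j = a ∨ (j = b ∧ LeftDescent a L)

/-- The words none of whose letters is a left descent of the word that follows it. -/
def DescentFree : List (Fin 5) → Prop
  | [] => True
  | a :: L => ¬ LeftDescent a L ∧ DescentFree L

theorem LeftDescent.head (a : Fin 5) (L : List (Fin 5)) : LeftDescent a (a :: L) := by
  cases L <;> simp [LeftDescent]

theorem LeftDescent.exists_isBadPattern_append {j : Fin 5} {L : List (Fin 5)}
    (h : LeftDescent j L) : ∃ B C : List (Fin 5), j :: L = B ++ C ∧ IsBadPattern B := by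
  induction L using List.twoStepInduction generalizing j with
  | nil => exact h.elim
  | singleton a =>
    obtain rfl : j = a := h
    exact ⟨[j, j], [], rfl, Or.inl ⟨j, rfl⟩⟩
  | cons_cons a b L ih _ =>
    rcases h with rfl | ⟨rfl, h⟩
    · exact ⟨[j, j], b :: L, rfl, Or.inl ⟨j, rfl⟩⟩
    obtain ⟨B, C, hBC, ⟨i, rfl⟩ | ⟨m, f, hm, rfl, h0, hlast, hmid⟩⟩ := ih h
    · obtain ⟨rfl, rfl⟩ : a = i ∧ L = i :: C := by simpa using hBC
      refine ⟨[j, a, j, a], C, rfl, Or.inr ⟨2, ![j, a, j, a] ∘ Fin.ofNat 4, le_rfl, rfl, rfl,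
        rfl, fun k hk hk' => ?_⟩⟩
      omega
    · obtain ⟨n, rfl⟩ : ∃ n, m = n + 2 := ⟨m - 2, by omega⟩
      have hr : 2 * (n + 2) = 2 * n + 3 + 1 := by ring
      rw [hr, List.range_succ_eq_map] at hBC
      simp only [List.map_cons, List.map_map, List.cons_append, List.cons.injEq] at hBC
      obtain ⟨rfl, rfl⟩ := hBC
      let g : ℕ → Fin 5
        | 0 => j
        | 1 => f 0
        | 2 => j
        | k + 3 => f (k + 1)
      refine ⟨(List.range (2 * (n + 3))).map g, C, ?_, Or.inr ⟨n + 3, g, by omega, rfl, rfl,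
        ?_, fun k hk hk' => ?_⟩⟩
      · have hr' : 2 * (n + 3) = 2 * n + 3 + 1 + 1 + 1 := by ring
        rw [hr', List.range_succ_eq_map (n := 2 * n + 3 + 1 + 1),
          List.range_succ_eq_map (n := 2 * n + 3 + 1), List.range_succ_eq_map (n := 2 * n + 3)]
        simp only [List.map_cons, List.map_map, List.cons_append]
        rfl
      · have h1 : 2 * (n + 3) - 3 = 2 * n + 3 := by omega
        have h2 : 2 * (n + 3) - 1 = 2 * n + 2 + 3 := by omega
        have h3 : 2 * (n + 2) - 3 = 2 * n + 1 := by omega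
        have h4 : 2 * (n + 2) - 1 = 2 * n + 3 := by omega
        rw [h3, h4] at hlast
        rw [h1, h2]
        exact hlast
      · obtain rfl | ⟨l, rfl⟩ : k = 1 ∨ ∃ l, k = l + 2 := by
          rcases k with _ | _ | l
          · omega
          · exact Or.inl rfl
          · exact Or.inr ⟨l, rfl⟩
        · exact h0
        · have h1 : 2 * (l + 2) - 1 = 2 * l + 3 := by omega
          have h2 : 2 * (l + 2) + 2 = 2 * l + 3 + 3 := by omega
          have h3 := hmid (l + 1) (by omega) (by omega)
          have h4 : 2 * (l + 1) - 1 = 2 * l + 1 := by omega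
          have h5 : 2 * (l + 1) + 2 = 2 * l + 4 := by omega
          rw [h4, h5] at h3
          rw [h1, h2]
          exact h3

theorem IsReducedWord.of_cons {a : Fin 5} {L : List (Fin 5)} (h : IsReducedWord (a :: L)) :
    IsReducedWord L := fun ⟨A, B, C, hL, hB⟩ => h ⟨a :: A, B, C, by simp [hL], hB⟩

theorem IsReducedWord.descentFree {L : List (Fin 5)} (h : IsReducedWord L) :
    DescentFree L := by
  induction L with
  | nil => trivial
  | cons a L ih =>
    refine ⟨fun hd => ?_, ih h.of_cons⟩
    obtain ⟨B, C, hBC, hB⟩ := hd.exists_isBadPattern_append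
    exact h ⟨[], B, C, hBC, hB⟩

/-- The sign pattern `x` of gains is compatible with the set `D` of left descents. -/
structure DescentCompatible (D : Fin 5 → Prop) (x : Fin 5 → ℚ) : Prop where
  nonpos : ∀ j, D j → x j ≤ 0
  nonneg : ∀ j, ¬ D j → 0 ≤ x j
  add_nonneg : ∀ a b c, D a → D b → a ≠ b → c ≠ a → c ≠ b → 0 ≤ x a + x b + x c

theorem DescentFree.descentCompatible {w : Fin 5 → ℚ} (hw : ∀ i, 0 ≤ massGain w i)
    {L : List (Fin 5)} (hL : DescentFree L) :
    DescentCompatible (LeftDescent · L) (massGain (wordAction w L)) := by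
  induction L using List.twoStepInduction with
  | nil =>
    have hnil : wordAction w [] = w := by simp [wordAction]
    rw [hnil]
    exact ⟨fun _ h => h.elim, fun j _ => hw j, fun _ _ _ h => h.elim⟩
  | singleton a =>
    have hone : wordAction w [a] = (apollonianGen 3 a).mulVec w := by simp [wordAction]
    rw [hone]
    refine ⟨?_, ?_, ?_⟩
    · rintro j rfl
      rw [massGain_apollonianGen_mulVec_self]
      linarith [hw j]
    · intro j (hj : j ≠ a)
      rw [massGain_apollonianGen_mulVec_of_ne hj]
      linarith [hw j, hw a]
    · rintro b c _ rfl rfl hbc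
      exact (hbc rfl).elim
  | cons_cons a b L ihL ihbL =>
    obtain ⟨ha, hb, hL⟩ := hL
    have hab : a ≠ b := fun h => ha (h ▸ LeftDescent.head a L)
    have IL := ihL hL
    have IbL := ihbL b ⟨hb, hL⟩
    have hxb := IL.nonneg b hb
    have hya := IbL.nonneg a ha
    have hyb := IbL.nonpos b (LeftDescent.head b L)
    have ya : massGain (wordAction w (b :: L)) a =
        massGain (wordAction w L) a + massGain (wordAction w L) b := by
      rw [wordAction_cons, massGain_apollonianGen_mulVec_of_ne hab]
    have yb : massGain (wordAction w (b :: L)) b = -massGain (wordAction w L) b := by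
      rw [wordAction_cons, massGain_apollonianGen_mulVec_self]
    have za : massGain (wordAction w (a :: b :: L)) a = -massGain (wordAction w (b :: L)) a := by
      rw [wordAction_cons, massGain_apollonianGen_mulVec_self]
    have zne : ∀ j, j ≠ a → massGain (wordAction w (a :: b :: L)) j =
        massGain (wordAction w (b :: L)) j + massGain (wordAction w (b :: L)) a := fun j hj => by
      rw [wordAction_cons, massGain_apollonianGen_mulVec_of_ne hj]
    have zb := zne b hab.symm
    have triple : ∀ c, c ≠ a → c ≠ b → LeftDescent a L →
        0 ≤ massGain (wordAction w (a :: b :: L)) a + massGain (wordAction w (a :: b :: L)) b +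
          massGain (wordAction w (a :: b :: L)) c := fun c hca hcb hd => by
      have zc := zne c hca
      have yc : massGain (wordAction w (b :: L)) c =
          massGain (wordAction w L) c + massGain (wordAction w L) b := by
        rw [wordAction_cons, massGain_apollonianGen_mulVec_of_ne hcb]
      by_cases hc : LeftDescent c L
      · have := IL.add_nonneg a c b hd hc hca.symm hab.symm hcb.symm
        linarith
      · have := IL.nonneg c hc
        linarith
    refine ⟨?_, ?_, ?_⟩
    · rintro j (rfl | ⟨rfl, hd⟩)
      · linarith
      · have := IL.nonpos a hd
        linarith
    · intro j hj
      have hja : j ≠ a := fun h => hj (Or.inl h)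
      by_cases hjb : j = b
      · subst hjb
        have := IL.nonneg a fun h => hj (Or.inr ⟨rfl, h⟩)
        linarith
      · have zj := zne j hja
        by_cases hd : LeftDescent j (b :: L)
        · have := IbL.add_nonneg b j a (LeftDescent.head b L) hd (Ne.symm hjb) hab hja.symm
          linarith
        · have := IbL.nonneg j hd
          linarith
    · rintro c d e (rfl | ⟨rfl, hc⟩) (rfl | ⟨rfl, hd⟩) hcd hec hed
      · exact (hcd rfl).elim
      · exact triple e hec hed hd
      · have := triple e hed hec hc
        linarith
      · exact (hcd rfl).elim

/-- Let `w ∈ ℚ^5` be a weight vector with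
`Σ^w(R_i) ≥ Σ^w(I)` for every `1 ≤ i ≤ 5`.  Then for every reduced word
`U = U_1 U_2 ⋯ U_n` over `{R_1, …, R_5}` with `n ≥ 1`, writing `U_1 = R_i` and
`U' = U_2 ⋯ U_n` (so `U = R_i U'` as matrix product, with `U' = I` when `n = 1`),
one has `Σ^w(U) ≥ Σ^w(U')`. -/
theorem weightedMass_of_reduced_word_ge (w : Fin 5 → ℚ)
    (hw : ∀ i : Fin 5, weightedMass w (apollonianGen 3 i) ≥ weightedMass w 1)
    (i : Fin 5) (L' : List (Fin 5)) (hred : IsReducedWord (i :: L')) :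
    weightedMass w (((i :: L').map (apollonianGen 3)).prod) ≥
      weightedMass w ((L'.map (apollonianGen 3)).prod) := by
  have hw' : ∀ j, 0 ≤ massGain w j := fun j => by
    have h := weightedMass_apollonianGen_mul w j 1
    rw [mul_one, Matrix.one_mulVec] at h
    linarith [hw j]
  obtain ⟨hi, hL'⟩ := hred.descentFree
  have hgain := (hL'.descentCompatible hw').nonneg i hi
  rw [List.map_cons, List.prod_cons, weightedMass_apollonianGen_mul]
  exact le_add_of_nonneg_right hgain
end

section
/- Let d ≥ 2 be an integer with d ≠ 3, let w = (−1, 1, …, 1)ᵀ ∈ ℚ^{d+2}, and let U = U_n⋯U_2U_1 be a product of matrices U_k ∈ {R_1, …, R_{d+2}} such that U_1 = R_1 and no two consecutive factors are equal (U_k ≠ U_{k+1} for 1 ≤ k < n). Then for every index i such that R_i occurs among U_1, …, U_n, the i-th entry of the vector Uw is different from 1, i.e., σ_i^w(U) = e_iᵀUw ≠ 1. -/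
theorem apollonianGen_mulVec_of_ne {d : ℕ} {j k : Fin (d + 2)} (h : k ≠ j)
    (x : Fin (d + 2) → ℚ) : (apollonianGen d j).mulVec x k = x k := by
  simp [Matrix.mulVec, dotProduct, apollonianGen, h]

theorem apollonianGen_mulVec_self {d : ℕ} (j : Fin (d + 2)) (x : Fin (d + 2) → ℚ) :
    (apollonianGen d j).mulVec x j
      = -x j + 2 / ((d : ℚ) - 1) * ∑ k ∈ Finset.univ.erase j, x k := by
  rw [Matrix.mulVec, dotProduct, ← Finset.add_sum_erase _ _ (Finset.mem_univ j), Finset.mul_sum]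
  congr 1
  · simp [apollonianGen]
  · exact Finset.sum_congr rfl fun k hk => by simp [apollonianGen, Finset.ne_of_mem_erase hk]

theorem sum_erase_neg_one_one (d : ℕ) :
    ∑ k ∈ Finset.univ.erase (0 : Fin (d + 2)), (if k = 0 then (-1 : ℚ) else 1) = d + 1 := by
  rw [Finset.sum_congr rfl fun k hk => if_neg (Finset.ne_of_mem_erase hk)]
  simp [Finset.card_erase_of_mem]

/-- An invariant of a vector together with the index of the generator applied last, preserved by
every generator with a different index and forcing the entry at that index to differ from `1`,
keeps every touched entry different from `1`. -/
theorem entry_ne_one_of_invariant {d : ℕ} {w : Fin (d + 2) → ℚ}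
    (P : (Fin (d + 2) → ℚ) → Fin (d + 2) → Prop)
    (base : P ((apollonianGen d 0).mulVec w) 0)
    (step : ∀ x i j, i ≠ j → P x i → P ((apollonianGen d j).mulVec x) j)
    (ne_one : ∀ x i, P x i → x i ≠ 1)
    (L : List (Fin (d + 2))) (hne : L ≠ []) (hfirst : L.getLast hne = 0)
    (hconsec : L.IsChain (· ≠ ·)) :
    P (((L.map (apollonianGen d)).prod).mulVec w) (L.head hne) ∧
      ∀ i ∈ L, ((L.map (apollonianGen d)).prod).mulVec w i ≠ 1 := by
  induction L with
  | nil => exact absurd rfl hne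
  | cons j L ih =>
    cases L with
    | nil =>
      obtain rfl : j = 0 := by simpa using hfirst
      simpa using ⟨base, ne_one _ _ base⟩
    | cons k L =>
      rw [List.isChain_cons_cons] at hconsec
      obtain ⟨hP, hL⟩ := ih (by simp) (by simpa using hfirst) hconsec.2
      rw [List.map_cons, List.prod_cons, ← Matrix.mulVec_mulVec]
      have hPj := step _ k j hconsec.1.symm hP
      refine ⟨hPj, fun i hi => ?_⟩
      by_cases hij : i = j
      · subst hij
        exact ne_one _ _ hPj
      · rw [apollonianGen_mulVec_of_ne hij]
        exact hL i ((List.mem_cons.1 hi).resolve_left hij)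

/-- The `i`-th entry of `x` is strictly `p`-adically larger than `1` and than all other entries. -/
def PadicDominant (p : ℕ) {n : ℕ} (x : Fin n → ℚ) (i : Fin n) : Prop :=
  1 < padicNorm p (x i) ∧ ∀ k, k ≠ i → padicNorm p (x k) < padicNorm p (x i)

theorem PadicDominant.ne_one {p n : ℕ} {x : Fin n → ℚ} {i : Fin n} (h : PadicDominant p x i) :
    x i ≠ 1 := by
  intro hx
  simpa [hx] using h.1

theorem padicNorm_add_eq_left {p : ℕ} [Fact p.Prime] {q r : ℚ}
    (h : padicNorm p r < padicNorm p q) : padicNorm p (q + r) = padicNorm p q := by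
  rw [padicNorm.add_eq_max_of_ne h.ne', max_eq_left h.le]

theorem PadicDominant.mulVec {p d : ℕ} [Fact p.Prime]
    (hc : 1 < padicNorm p (2 / ((d : ℚ) - 1))) {x : Fin (d + 2) → ℚ} {i j : Fin (d + 2)}
    (hij : i ≠ j) (h : PadicDominant p x i) :
    PadicDominant p ((apollonianGen d j).mulVec x) j := by
  obtain ⟨h1, h2⟩ := h
  have hpos : 0 < padicNorm p (x i) := one_pos.trans h1
  have hsum : padicNorm p (∑ k ∈ Finset.univ.erase j, x k) = padicNorm p (x i) := by
    rw [← Finset.add_sum_erase _ _ (Finset.mem_erase.2 ⟨hij, Finset.mem_univ i⟩)]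
    exact padicNorm_add_eq_left
      (padicNorm.sum_lt' (fun k hk => h2 k (Finset.ne_of_mem_erase hk)) hpos)
  have hlt : padicNorm p (x i) < padicNorm p ((apollonianGen d j).mulVec x j) := by
    have hmul : padicNorm p (x i)
        < padicNorm p (2 / ((d : ℚ) - 1) * ∑ k ∈ Finset.univ.erase j, x k) := by
      rw [padicNorm.mul, hsum]
      exact lt_mul_of_one_lt_left hpos hc
    rw [apollonianGen_mulVec_self, add_comm, padicNorm_add_eq_left]
    · exact hmul
    · rw [padicNorm.neg]
      exact (h2 j hij.symm).trans hmul
  refine ⟨h1.trans hlt, fun k hk => ?_⟩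
  rw [apollonianGen_mulVec_of_ne hk]
  by_cases hki : k = i
  · exact hki ▸ hlt
  · exact (h2 k hki).trans hlt

theorem exists_prime_one_lt_padicNorm {q : ℚ} (hq : q.den ≠ 1) :
    ∃ p : ℕ, p.Prime ∧ 1 < padicNorm p q := by
  obtain ⟨p, hp, hpd⟩ := Nat.exists_prime_and_dvd hq
  have : Fact p.Prime := ⟨hp⟩
  refine ⟨p, hp, ?_⟩
  have hden : padicNorm p q.den < 1 := (padicNorm.nat_lt_one_iff _).2 hpd
  have hden0 : 0 < padicNorm p q.den :=
    (padicNorm.nonneg _).lt_of_ne' (padicNorm.nonzero (Nat.cast_ne_zero.2 q.den_ne_zero))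
  have hnum : padicNorm p q.num = 1 := by
    rw [padicNorm.int_eq_one_iff, Int.natCast_dvd]
    exact fun h => hp.not_dvd_one (q.reduced ▸ Nat.dvd_gcd h hpd)
  rw [← Rat.num_div_den q, padicNorm.div, hnum]
  exact one_lt_one_div hden0 hden

/-- All entries of `x` are at least `1`, and the `i`-th is a largest entry, exceeding `1`. -/
def Dominant {n : ℕ} (x : Fin n → ℚ) (i : Fin n) : Prop :=
  1 < x i ∧ ∀ k, 1 ≤ x k ∧ x k ≤ x i

theorem Dominant.mulVec {x : Fin (2 + 2) → ℚ} {i j : Fin (2 + 2)}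
    (hij : i ≠ j) (h : Dominant x i) : Dominant ((apollonianGen 2 j).mulVec x) j := by
  obtain ⟨h1, h2⟩ := h
  have hle : x i ≤ (apollonianGen 2 j).mulVec x j := by
    rw [apollonianGen_mulVec_self]
    have hsum : x i ≤ ∑ k ∈ Finset.univ.erase j, x k :=
      Finset.single_le_sum (fun k _ => zero_le_one.trans (h2 k).1)
        (Finset.mem_erase.2 ⟨hij, Finset.mem_univ i⟩)
    rw [show (2 / (((2 : ℕ) : ℚ) - 1)) = 2 by norm_num]
    linarith [(h2 j).2]
  refine ⟨h1.trans_le hle, fun k => ?_⟩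
  by_cases hk : k = j
  · subst hk
    exact ⟨h1.le.trans hle, le_rfl⟩
  · rw [apollonianGen_mulVec_of_ne hk]
    exact ⟨(h2 k).1, (h2 k).2.trans hle⟩

theorem dominant_initial :
    Dominant ((apollonianGen 2 0).mulVec fun j => if j = 0 then (-1 : ℚ) else 1) 0 := by
  have h0 : (apollonianGen 2 0).mulVec (fun j => if j = 0 then (-1 : ℚ) else 1) 0 = 7 := by
    rw [apollonianGen_mulVec_self, sum_erase_neg_one_one]
    norm_num
  refine ⟨by rw [h0]; norm_num, fun k => ?_⟩
  by_cases hk : k = 0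
  · rw [hk, h0]
    norm_num
  · rw [apollonianGen_mulVec_of_ne hk, h0]
    norm_num [hk]

theorem padicDominant_initial {p d : ℕ} [Fact p.Prime] (hd : 2 ≤ d)
    (hp : 1 < padicNorm p (4 / ((d : ℚ) - 1))) :
    PadicDominant p ((apollonianGen d 0).mulVec fun j => if j = 0 then (-1 : ℚ) else 1) 0 := by
  have hd' : (d : ℚ) - 1 ≠ 0 := by
    have : (2 : ℚ) ≤ d := by exact_mod_cast hd
    linarith
  have h0 : 1 < padicNorm p
      ((apollonianGen d 0).mulVec (fun j => if j = 0 then (-1 : ℚ) else 1) 0) := by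
    have hval : (apollonianGen d 0).mulVec (fun j => if j = 0 then (-1 : ℚ) else 1) 0
        = 4 / ((d : ℚ) - 1) + (3 : ℕ) := by
      rw [apollonianGen_mulVec_self, sum_erase_neg_one_one]
      simp only [if_true]
      field_simp
      push_cast
      ring
    rw [hval, padicNorm_add_eq_left ((padicNorm.of_nat 3).trans_lt hp)]
    exact hp
  refine ⟨h0, fun k hk => ?_⟩
  rw [apollonianGen_mulVec_of_ne hk]
  simpa [hk] using h0

theorem one_lt_padicNorm_two_div {p : ℕ} [Fact p.Prime] {q : ℚ} (hp : 1 < padicNorm p (4 / q)) :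
    1 < padicNorm p (2 / q) := by
  have h : (4 / q : ℚ) = (2 : ℕ) * (2 / q) := by
    push_cast
    ring
  rw [h, padicNorm.mul] at hp
  exact hp.trans_le (mul_le_of_le_one_left (padicNorm.nonneg _) (padicNorm.of_nat 2))

theorem apollonianGen_five_initial :
    (apollonianGen 5 0).mulVec (fun j => if j = 0 then (-1 : ℚ) else 1)
      = fun j => if j = 0 then 4 else 1 := by
  funext k
  by_cases hk : k = 0
  · rw [hk, apollonianGen_mulVec_self, sum_erase_neg_one_one]
    norm_num
  · rw [apollonianGen_mulVec_of_ne hk]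
    simp [hk]

theorem padicDominant_five_second {j : Fin (5 + 2)} (hj : 0 ≠ j) :
    PadicDominant 2 ((apollonianGen 5 j).mulVec fun k => if k = 0 then (4 : ℚ) else 1) j := by
  have hval : (apollonianGen 5 j).mulVec (fun k => if k = 0 then (4 : ℚ) else 1) j
      = (7 : ℕ) / (2 : ℕ) := by
    have hsum := Finset.add_sum_erase Finset.univ
      (fun k : Fin (5 + 2) => if k = 0 then (4 : ℚ) else 1) (Finset.mem_univ j)
    rw [Fin.sum_univ_succ] at hsum
    simp only [if_neg hj.symm, if_true, Fin.succ_ne_zero, if_false, Finset.sum_const,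
      Finset.card_univ, Fintype.card_fin, nsmul_eq_mul] at hsum
    rw [apollonianGen_mulVec_self, if_neg hj.symm]
    push_cast at hsum ⊢
    linarith
  have hnorm : padicNorm 2 ((7 : ℕ) / (2 : ℕ)) = 2 := by
    rw [padicNorm.div, (padicNorm.nat_eq_one_iff 7).2 (by decide), padicNorm.padicNorm_p_of_prime]
    norm_num
  refine ⟨by rw [hval, hnorm]; norm_num, fun k hk => ?_⟩
  rw [apollonianGen_mulVec_of_ne hk, hval, hnorm]
  by_cases h0 : k = 0
  · rw [if_pos h0]
    have := padicNorm.of_nat (p := 2) 4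
    push_cast at this
    linarith
  · simp [h0]

theorem den_four_div_ne_one {d : ℕ} (hd : 2 ≤ d) (h2 : d ≠ 2) (h3 : d ≠ 3) (h5 : d ≠ 5) :
    (4 / ((d : ℚ) - 1)).den ≠ 1 := by
  intro h
  obtain ⟨m, rfl⟩ : ∃ m, d = m + 1 := ⟨d - 1, by omega⟩
  have hm : (m : ℚ) ≠ 0 := Nat.cast_ne_zero.2 (by omega)
  have hz := Rat.den_eq_one_iff _ |>.1 h
  generalize (4 / (((m + 1 : ℕ) : ℚ) - 1)).num = z at hz
  rw [Nat.cast_add_one, add_sub_cancel_right, eq_div_iff hm] at hz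
  have hdvd : (m : ℤ) ∣ 4 := Dvd.intro_left z (by exact_mod_cast hz)
  have hdvd' : m ∣ 4 := by exact_mod_cast hdvd
  have hle := Nat.le_of_dvd (by norm_num) hdvd'
  interval_cases m <;> omega

/-- Let `d ≥ 2`, `d ≠ 3`, and `w = (−1, 1, …, 1)ᵀ ∈ ℚ^{d+2}`.
Let `U = U_n ⋯ U_2 U_1` be a product of generators `U_k ∈ {R_1, …, R_{d+2}}`
(the list `L = [U_n, …, U_2, U_1]` records the factors, so `U` is the product of
`L` in order) such that `U_1 = R_1` and no two consecutive factors are equal.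
Then for every index `i` such that `R_i` occurs among the factors,
`σ_i^w(U) = e_iᵀ U w ≠ 1`. -/
theorem weightedRowSum_ne_one (d : ℕ) (hd : 2 ≤ d) (hd3 : d ≠ 3)
    (L : List (Fin (d + 2))) (hne : L ≠ [])
    (hfirst : L.getLast hne = 0)
    (hconsec : L.Chain' (· ≠ ·))
    (i : Fin (d + 2)) (hi : i ∈ L) :
    weightedRowSum (fun j => if j = 0 then (-1 : ℚ) else 1)
      ((L.map (apollonianGen d)).prod) i ≠ 1 := by
  rw [weightedRowSum]
  by_cases h2 : d = 2
  · subst h2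
    exact (entry_ne_one_of_invariant Dominant dominant_initial
      (fun _ _ _ hij h => h.mulVec hij) (fun _ _ h => h.1.ne') L hne hfirst hconsec).2 i hi
  by_cases h5 : d = 5
  · subst h5
    refine (entry_ne_one_of_invariant
      (fun x i => PadicDominant 2 x i ∨ i = 0 ∧ x = fun k => if k = 0 then (4 : ℚ) else 1)
      (Or.inr ⟨rfl, apollonianGen_five_initial⟩) ?_ ?_ L hne hfirst hconsec).2 i hi
    · rintro x i j hij (h | ⟨rfl, rfl⟩)
      · refine Or.inl (h.mulVec ?_ hij)
        rw [show (2 / (((5 : ℕ) : ℚ) - 1)) = (1 : ℚ) / (2 : ℕ) by norm_num, padicNorm.div,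
          padicNorm.padicNorm_p_of_prime]
        norm_num
      · exact Or.inl (padicDominant_five_second hij)
    · rintro x i (h | ⟨rfl, rfl⟩)
      · exact h.ne_one
      · norm_num
  obtain ⟨p, hp, hlt⟩ := exists_prime_one_lt_padicNorm (den_four_div_ne_one hd h2 hd3 h5)
  have : Fact p.Prime := ⟨hp⟩
  exact (entry_ne_one_of_invariant (PadicDominant p) (padicDominant_initial hd hlt)
    (fun _ _ _ hij h => h.mulVec (one_lt_padicNorm_two_div hlt) hij) (fun _ _ h => h.ne_one)
    L hne hfirst hconsec).2 i hi
end
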